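/- Let P and Q be probability measures on Ω₁×⋯×Ω_n (standard Borel spaces) that are both Bayes-nets with respect to a common DAG G with topological ordering (1,…,n) and parent sets Π_i ⊆ {1,…,i−1}. Then the Symmetric KL divergence satisfies SKL(P,Q) ≤ Σ_{i=1}^n SKL(P_{X_i∪X_{Π_i}}, Q_{X_i∪X_{Π_i}}). -/

import Mathlib

open MeasureTheory ProbabilityTheory Filter
open scoped ENNReal NNReal

noncomputable section

universe u

/-- Projection of a point of a product space onto the coordinates in `S`. -/
def proj {n : ℕ} {Ω : Fin n → Type*} (S : Finset (Fin n)) (x : ∀ i, Ω i) (i : S) : Ω i := x i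

lemma measurable_proj {n : ℕ} {Ω : Fin n → Type*} [∀ i, MeasurableSpace (Ω i)]
    (S : Finset (Fin n)) : Measurable (proj (Ω := Ω) S) :=
  measurable_pi_lambda _ fun _ => measurable_pi_apply _

/-- A finite measure `P` on a product of standard Borel spaces is a Bayes-net with respect to
the parent structure `par` (for the topological ordering `0 < 1 < ⋯ < n-1`) if, for every `i`,
the `i`-th coordinate is conditionally independent of the tuple of previous coordinates given
the tuple of parent coordinates `par i`. -/
def IsBayesNet {n : ℕ} {Ω : Fin n → Type*} [∀ i, MeasurableSpace (Ω i)]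
    [∀ i, StandardBorelSpace (Ω i)] [∀ i, Nonempty (Ω i)]
    (P : Measure (∀ i, Ω i)) [IsFiniteMeasure P] (par : Fin n → Finset (Fin n)) : Prop :=
  ∀ i : Fin n,
    CondIndepFun (MeasurableSpace.comap (proj (par i)) inferInstance)
      ((measurable_proj (par i)).comap_le) (fun x => x i) (proj (Finset.Iio i)) P

open scoped Classical in
/-- The Kullback-Leibler divergence `KL(P,Q) = ∫ log (dP/dQ) dP` when `P ≪ Q` (and the
integral exists), and `+∞` otherwise. -/
def klDiv {Ω : Type*} [MeasurableSpace Ω] (P Q : Measure Ω) : ℝ≥0∞ :=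
  if P ≪ Q ∧ Integrable (fun x => Real.log ((P.rnDeriv Q x).toReal)) P
  then ENNReal.ofReal (∫ x, Real.log ((P.rnDeriv Q x).toReal) ∂P)
  else ⊤

/-- The Symmetric Kullback-Leibler divergence `SKL(P,Q) = KL(P,Q) + KL(Q,P)`. -/
def sklDiv {Ω : Type*} [MeasurableSpace Ω] (P Q : Measure Ω) : ℝ≥0∞ :=
  klDiv P Q + klDiv Q P

/-- For probability measures, `klDiv` agrees with Mathlib's Kullback-Leibler divergence. -/
lemma klDiv_eq_informationTheory_klDiv {α : Type*} [MeasurableSpace α] (P Q : Measure α)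
    [IsProbabilityMeasure P] [IsProbabilityMeasure Q] :
    klDiv P Q = InformationTheory.klDiv P Q := by
  rw [klDiv, InformationTheory.klDiv_def]
  simp only [llr_def, probReal_univ, add_sub_cancel_right]
  congr

/-- Data processing inequality for two random variables, one a function of the other. -/
lemma klDiv_map_le_klDiv_map_of_comp {α β γ : Type*} [MeasurableSpace α] [MeasurableSpace β]
    [MeasurableSpace γ] (P Q : Measure α) [IsFiniteMeasure P] [IsFiniteMeasure Q]
    {f : α → β} {g : α → γ} {φ : β → γ} (hf : Measurable f) (hφ : Measurable φ)
    (h : ∀ x, φ (f x) = g x) :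
    InformationTheory.klDiv (P.map g) (Q.map g) ≤
      InformationTheory.klDiv (P.map f) (Q.map f) := by
  obtain rfl : φ ∘ f = g := funext h
  rw [← Measure.map_map hφ hf, ← Measure.map_map hφ hf]
  exact InformationTheory.klDiv_map_le _ _ hφ

/-- Composing `μ` with a kernel depending only on the first coordinate amounts to composing its
first marginal with that kernel, then resampling the second coordinate independently. -/
lemma map_compProd_condKernel_prodMkRight {α β γ : Type*} [MeasurableSpace α] [MeasurableSpace β]
    [StandardBorelSpace β] [Nonempty β] [MeasurableSpace γ] (μ : Measure (α × β))
    [IsFiniteMeasure μ] (κ : Kernel α γ) [IsMarkovKernel κ] :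
    ((μ.fst ⊗ₘ κ) ⊗ₘ μ.condKernel.prodMkRight γ).map (fun p => ((p.1.1, p.2), p.1.2)) =
      μ ⊗ₘ κ.prodMkRight β := by
  refine Measure.ext_of_lintegral _ fun F hF => ?_
  have hκ : Measurable fun p : α × β => ∫⁻ c, F (p, c) ∂κ p.1 :=
    Measurable.lintegral_kernel_prod_right' (κ := κ.prodMkRight β) hF
  have hρ : Measurable fun p : α × γ => ∫⁻ b, F ((p.1, b), p.2) ∂μ.condKernel p.1 :=
    Measurable.lintegral_kernel_prod_right' (κ := μ.condKernel.prodMkRight γ)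
      (f := fun q : (α × γ) × β => F ((q.1.1, q.2), q.1.2)) (by fun_prop)
  rw [lintegral_map hF (by fun_prop), Measure.lintegral_compProd (by fun_prop),
    Measure.lintegral_compProd hF]
  simp only [Kernel.prodMkRight_apply]
  rw [Measure.lintegral_compProd hρ]
  conv_rhs => rw [← μ.disintegrate μ.condKernel]
  rw [Measure.lintegral_compProd hκ]
  exact lintegral_congr fun a =>
    lintegral_lintegral_swap (μ := κ a) (ν := μ.condKernel a) (f := fun c b => F ((a, b), c))
      (by fun_prop)

/-- The conditional divergence of two kernels that only depend on the first coordinate is bounded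
by the conditional divergence over the first marginal. -/
lemma klDiv_compProd_prodMkRight_le {α β γ : Type*} [MeasurableSpace α] [MeasurableSpace β]
    [StandardBorelSpace β] [Nonempty β] [MeasurableSpace γ] (μ : Measure (α × β))
    [IsFiniteMeasure μ] (κ η : Kernel α γ) [IsMarkovKernel κ] [IsMarkovKernel η] :
    InformationTheory.klDiv (μ ⊗ₘ κ.prodMkRight β) (μ ⊗ₘ η.prodMkRight β) ≤
      InformationTheory.klDiv (μ.fst ⊗ₘ κ) (μ.fst ⊗ₘ η) := by
  rw [← map_compProd_condKernel_prodMkRight μ κ, ← map_compProd_condKernel_prodMkRight μ η]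
  refine (InformationTheory.klDiv_map_le _ _ (by fun_prop)).trans_eq ?_
  exact InformationTheory.klDiv_compProd_left _ _ _

/-- If `g` and `f` are conditionally independent given `k` under both measures, then the
divergence between the laws of `(k, g, f)` is at most the sum of those between the laws of
`(k, g)` and of `(k, f)`. -/
lemma klDiv_map_le_add_of_condIndepFun {α β γ δ : Type*} [MeasurableSpace α]
    [StandardBorelSpace α] [MeasurableSpace β] [StandardBorelSpace β] [Nonempty β]
    [MeasurableSpace γ] [StandardBorelSpace γ] [Nonempty γ] [MeasurableSpace δ]
    (P Q : Measure α) [IsFiniteMeasure P] [IsFiniteMeasure Q]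
    {f : α → β} {g : α → γ} {k : α → δ} (hf : Measurable f) (hg : Measurable g)
    (hk : Measurable k) (hP : CondIndepFun _ hk.comap_le g f P)
    (hQ : CondIndepFun _ hk.comap_le g f Q) :
    InformationTheory.klDiv (P.map fun x => ((k x, g x), f x)) (Q.map fun x => ((k x, g x), f x)) ≤
      InformationTheory.klDiv (P.map fun x => (k x, g x)) (Q.map fun x => (k x, g x)) +
      InformationTheory.klDiv (P.map fun x => (k x, f x)) (Q.map fun x => (k x, f x)) := by
  have hfac (R : Measure α) [IsFiniteMeasure R] (hR : CondIndepFun _ hk.comap_le g f R) :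
      (R.map fun x => ((k x, g x), f x)) =
        (R.map fun x => (k x, g x)) ⊗ₘ (condDistrib f k R).prodMkRight γ := by
    rw [condIndepFun_iff_condDistrib_prod_ae_eq_prodMkRight hf hg hk] at hR
    rw [← Measure.compProd_congr hR, compProd_map_condDistrib hf.aemeasurable]
  rw [hfac P hP, hfac Q hQ, InformationTheory.klDiv_compProd_eq_add]
  gcongr
  refine (klDiv_compProd_prodMkRight_le _ _ _).trans ?_
  rw [Measure.fst_map_prodMk hg, ← compProd_map_condDistrib (μ := P) hf.aemeasurable,
    ← compProd_map_condDistrib (μ := Q) hf.aemeasurable,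
    InformationTheory.klDiv_compProd_eq_add (P.map k) (Q.map k)]
  exact le_add_self

lemma measurable_proj_of_subset {n : ℕ} {Ω : Fin n → Type*} [∀ i, MeasurableSpace (Ω i)]
    {S T : Finset (Fin n)} (h : S ⊆ T) :
    Measurable fun (y : ∀ i : T, Ω i) (i : S) => y ⟨i, h i.2⟩ :=
  measurable_pi_lambda _ fun _ => measurable_pi_apply _

/-- Adding one vertex of a Bayes-net to its predecessors increases the divergence by at most the
divergence between the marginals on that vertex and its parents. -/
lemma IsBayesNet.klDiv_map_proj_le_add {n : ℕ} {Ω : Fin n → Type*}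
    [∀ i, MeasurableSpace (Ω i)] [∀ i, StandardBorelSpace (Ω i)] [∀ i, Nonempty (Ω i)]
    {par : Fin n → Finset (Fin n)} (hpar : ∀ i, par i ⊆ Finset.Iio i)
    {P Q : Measure (∀ i, Ω i)} [IsFiniteMeasure P] [IsFiniteMeasure Q]
    (hP : IsBayesNet P par) (hQ : IsBayesNet Q par) (i : Fin n) :
    InformationTheory.klDiv (P.map (proj (Finset.Iic i))) (Q.map (proj (Finset.Iic i))) ≤
      InformationTheory.klDiv (P.map (proj (Finset.Iio i))) (Q.map (proj (Finset.Iio i))) +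
      InformationTheory.klDiv (P.map (proj (insert i (par i))))
        (Q.map (proj (insert i (par i)))) := by
  have hX : Measurable (proj (Ω := Ω) (Finset.Iio i)) := measurable_proj _
  have hZ : Measurable (proj (Ω := Ω) (par i)) := measurable_proj _
  have hY : Measurable fun x : ∀ j, Ω j => x i := measurable_pi_apply i
  refine le_trans ?_ ((klDiv_map_le_add_of_condIndepFun P Q hY hX hZ (hP i).symm
    (hQ i).symm).trans (add_le_add ?_ ?_))
  · let φ (p : ((∀ j : par i, Ω j) × (∀ j : Finset.Iio i, Ω j)) × Ω i) (j : Finset.Iic i) :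
        Ω j :=
      if h : (j : Fin n) = i then cast (by rw [h]) p.2 else
        p.1.2 ⟨j, Finset.mem_Iio.2 (lt_of_le_of_ne (Finset.mem_Iic.1 j.2) h)⟩
    refine klDiv_map_le_klDiv_map_of_comp P Q (φ := φ) (by fun_prop) ?_ fun x => ?_
    · refine measurable_pi_lambda _ fun ⟨j, hj⟩ => ?_
      by_cases h : j = i
      · subst h
        simp [φ, measurable_snd]
      · simp only [φ, h, dite_false]
        fun_prop
    · funext ⟨j, hj⟩
      by_cases h : j = i
      · subst h
        simp [φ, proj]
      · simp [φ, proj, h]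
  · exact klDiv_map_le_klDiv_map_of_comp P Q hX
      ((measurable_proj_of_subset (hpar i)).prodMk measurable_id) fun x => rfl
  · exact klDiv_map_le_klDiv_map_of_comp P Q (measurable_proj _)
      (φ := fun (y : ∀ j : (insert i (par i) : Finset (Fin n)), Ω j) =>
        ((fun j : par i => y ⟨j, Finset.mem_insert_of_mem j.2⟩),
          y ⟨i, Finset.mem_insert_self i (par i)⟩))
      ((measurable_proj_of_subset (Finset.subset_insert i (par i))).prodMk
        (measurable_pi_apply _)) fun x => rfl

/-- Subadditivity of the Kullback-Leibler divergence on Bayes-nets. -/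
lemma IsBayesNet.klDiv_le_sum {n : ℕ} {Ω : Fin n → Type*}
    [∀ i, MeasurableSpace (Ω i)] [∀ i, StandardBorelSpace (Ω i)] [∀ i, Nonempty (Ω i)]
    {par : Fin n → Finset (Fin n)} (hpar : ∀ i, par i ⊆ Finset.Iio i)
    {P Q : Measure (∀ i, Ω i)} [IsProbabilityMeasure P] [IsProbabilityMeasure Q]
    (hP : IsBayesNet P par) (hQ : IsBayesNet Q par) :
    klDiv P Q ≤ ∑ i : Fin n,
      klDiv (P.map (proj (insert i (par i)))) (Q.map (proj (insert i (par i)))) := by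
  have hprob (R : Measure (∀ i, Ω i)) [IsProbabilityMeasure R] (S : Finset (Fin n)) :
      IsProbabilityMeasure (R.map (proj S)) :=
    Measure.isProbabilityMeasure_map (measurable_proj S).aemeasurable
  simp only [klDiv_eq_informationTheory_klDiv]
  have key (k : ℕ) (hk : k ≤ n) : ∀ S : Finset (Fin n), (∀ j, j ∈ S ↔ (j : ℕ) < k) →
      InformationTheory.klDiv (P.map (proj S)) (Q.map (proj S)) ≤ ∑ i ∈ S,
        InformationTheory.klDiv (P.map (proj (insert i (par i))))
          (Q.map (proj (insert i (par i)))) := by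
    induction k with
    | zero =>
      intro S hS
      obtain rfl : S = ∅ := Finset.eq_empty_of_forall_notMem fun j => by simp [hS]
      have : P.map (proj ∅) = Q.map (proj ∅) := by
        refine Measure.ext fun s _ => ?_
        induction s using Subsingleton.set_cases with
        | h0 => simp
        | h1 => simp
      simp [this]
    | succ k ih =>
      intro S hS
      let i : Fin n := ⟨k, hk⟩
      obtain rfl : S = Finset.Iic i := by
        ext j
        rw [hS, Finset.mem_Iic, Fin.le_def, Nat.lt_succ_iff]
      refine (IsBayesNet.klDiv_map_proj_le_add hpar hP hQ i).trans ?_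
      rw [← Finset.Iio_insert, Finset.sum_insert (by simp), add_comm]
      gcongr
      exact ih (by omega) _ fun j => by rw [Finset.mem_Iio, Fin.lt_def]
  refine le_trans ?_ (key n le_rfl Finset.univ fun j => by simp)
  have h := klDiv_map_le_klDiv_map_of_comp P Q (g := id)
    (φ := fun (y : ∀ i : (Finset.univ : Finset (Fin n)), Ω i) i => y ⟨i, Finset.mem_univ i⟩)
    (measurable_proj Finset.univ) (measurable_pi_lambda _ fun _ => measurable_pi_apply _)
    fun x => rfl
  simpa using h

/-- Subadditivity of the Symmetric KL divergence on Bayes-nets. -/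
theorem sklDiv_subadditivity_bayes_net
    {n : ℕ} (Ω : Fin n → Type u) [∀ i, MeasurableSpace (Ω i)]
    [∀ i, StandardBorelSpace (Ω i)] [∀ i, Nonempty (Ω i)]
    (par : Fin n → Finset (Fin n)) (hpar : ∀ i, par i ⊆ Finset.Iio i)
    (P Q : Measure (∀ i, Ω i)) [IsProbabilityMeasure P] [IsProbabilityMeasure Q]
    (hP : IsBayesNet P par) (hQ : IsBayesNet Q par) :
    sklDiv P Q ≤ ∑ i : Fin n,
      sklDiv (P.map (proj (insert i (par i)))) (Q.map (proj (insert i (par i)))) := by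
  simp only [sklDiv, Finset.sum_add_distrib]
  exact add_le_add (hP.klDiv_le_sum hpar hQ) (hQ.klDiv_le_sum hpar hP)
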